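/- arXiv:1503.02349 — 2 statements merged into one kernel-verified Lean document; each statement's English description precedes it below -/
import Mathlib

section
/- Pocklington's theorem: let N > 1 be a natural number such that N − 1 = A·B with A > B, and suppose that for every prime p dividing A there exists a natural number a_p with a_p^(N−1) ≡ 1 (mod N) and gcd(a_p^((N−1)/p) − 1, N) = 1. Then N is prime. -/
theorem Nat.Prime.pow_dvd_of_not_dvd_div {p d n k : ℕ} (hp : p.Prime) (hd : d ∣ n)
    (hpn : ¬ d ∣ n / p) (hk : p ^ k ∣ n) : p ^ k ∣ d := by
  obtain ⟨e, rfl⟩ := hd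
  have hpe : ¬ p ∣ e := fun h => hpn (by rw [Nat.mul_div_assoc d h]; exact dvd_mul_right _ _)
  exact (((Nat.Prime.coprime_iff_not_dvd hp).2 hpe).pow_left k).dvd_of_dvd_mul_right hk

theorem Nat.Prime.pow_dvd_sub_one_of_pow_eq_one {q p n k : ℕ} (hq : q.Prime) (hp : p.Prime)
    {x : ZMod q} (hx : x ^ n = 1) (hxp : x ^ (n / p) ≠ 1) (hn : n ≠ 0) (hk : p ^ k ∣ n) :
    p ^ k ∣ q - 1 := by
  have : Fact q.Prime := ⟨hq⟩
  have hx0 : x ≠ 0 := by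
    rintro rfl
    simp [hn] at hx
  exact (hp.pow_dvd_of_not_dvd_div (orderOf_dvd_of_pow_eq_one hx)
    (fun h => hxp (orderOf_dvd_iff_pow_eq_one.1 h)) hk).trans
    (orderOf_dvd_of_pow_eq_one (ZMod.pow_card_sub_one_eq_one hx0))

theorem pocklington (N A B : ℕ) (hN : 1 < N) (hfac : N - 1 = A * B)
    (hAB : B < A)
    (hw : ∀ p : ℕ, p.Prime → p ∣ A →
      ∃ a : ℕ, a ^ (N - 1) ≡ 1 [MOD N] ∧ Nat.gcd (a ^ ((N - 1) / p) - 1) N = 1) :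
    N.Prime := by
  by_contra hNp
  have hq : N.minFac.Prime := Nat.minFac_prime hN.ne'
  have hqN : N.minFac ∣ N := Nat.minFac_dvd N
  have hsq : N.minFac ^ 2 ≤ N := Nat.minFac_sq_le_self (by lia) hNp
  have hA : A ∣ N.minFac - 1 := by
    rw [Nat.dvd_iff_prime_pow_dvd_dvd]
    intro p k hp hk
    rcases Nat.eq_zero_or_pos k with rfl | hk0
    · simp
    obtain ⟨a, ha, hgcd⟩ := hw p hp ((dvd_pow_self p hk0.ne').trans hk)
    have hpow : (a : ZMod N.minFac) ^ (N - 1) = 1 := by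
      exact_mod_cast (ZMod.natCast_eq_natCast_iff _ _ _).2 (ha.of_dvd hqN)
    refine hq.pow_dvd_sub_one_of_pow_eq_one hp hpow (fun h => ?_) (by lia)
      (hk.trans (hfac ▸ dvd_mul_right A B))
    have hmod : 1 ≡ a ^ ((N - 1) / p) [MOD N.minFac] :=
      (ZMod.natCast_eq_natCast_iff _ _ _).1 (by simpa using h.symm)
    have ha0 : 0 < a := by
      rcases Nat.eq_zero_or_pos a with rfl | h0
      · have : Fact N.minFac.Prime := ⟨hq⟩
        simp [show N - 1 ≠ 0 by lia] at hpow
      · exact h0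
    have hdvd := (Nat.modEq_iff_dvd' (Nat.one_le_pow _ a ha0)).1 hmod
    exact hq.one_lt.ne' (Nat.dvd_one.1 (hgcd ▸ Nat.dvd_gcd hdvd hqN))
  have hle : A ≤ N.minFac - 1 := Nat.le_of_dvd (Nat.sub_pos_of_lt hq.one_lt) hA
  have hle' : A + 1 ≤ N.minFac := by have := hq.one_lt; lia
  have hNe : N = A * B + 1 := by lia
  nlinarith [Nat.pow_le_pow_left hle' 2, Nat.mul_le_mul_left A hAB.le]
end

section
/- Pocklington's theorem, prime-power form: let p be a prime and g, B, e, a natural numbers with g ≥ 1, B ≥ 1, e ≥ 1, a ≥ 1. Set m = g·p and N = m + 1, and suppose m = B·p^e, B < p^e, a^m ≡ 1 (mod N), and gcd(a^g − 1, N) = 1. Then N is prime. -/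
/-- If `d` divides `g * p` but not `g`, then `d` has the full `p`-part of `g * p`. -/
theorem Nat.Prime.pow_dvd_of_dvd_mul_of_not_dvd {p g d e : ℕ} (hp : p.Prime)
    (hd : d ∣ g * p) (hdg : ¬ d ∣ g) (he : p ^ e ∣ g * p) : p ^ e ∣ d := by
  obtain ⟨k, hk⟩ := hd
  have hpk : ¬ p ∣ k := by
    rintro ⟨l, rfl⟩
    exact hdg ⟨l, Nat.eq_of_mul_eq_mul_right hp.pos (by rw [hk]; ring)⟩
  rw [hk] at he
  exact (((Nat.Prime.coprime_iff_not_dvd hp).2 hpk).pow_left e).dvd_of_dvd_mul_right he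

/-- Every prime factor `q` of `N` is `1` modulo `p ^ e` under the Pocklington condition at `p`. -/
theorem Nat.Prime.pow_dvd_sub_one_of_pocklington {p g e a N q : ℕ} (hp : p.Prime)
    (hq : q.Prime) (hqN : q ∣ N) (ha : 1 ≤ a) (he : p ^ e ∣ g * p)
    (hmod : a ^ (g * p) ≡ 1 [MOD N]) (hgcd : Nat.gcd (a ^ g - 1) N = 1) :
    p ^ e ∣ q - 1 := by
  have : Fact q.Prime := ⟨hq⟩
  have h1 : (a : ZMod q) ^ (g * p) = 1 := by
    exact_mod_cast (ZMod.natCast_eq_natCast_iff _ _ q).2 (hmod.of_dvd hqN)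
  have h2 : (a : ZMod q) ^ g ≠ 1 := by
    intro h
    have h' : 1 ≡ a ^ g [MOD q] := by
      rw [← ZMod.natCast_eq_natCast_iff]
      push_cast
      exact h.symm
    have hdvd : q ∣ a ^ g - 1 := (Nat.modEq_iff_dvd' (Nat.one_le_pow _ _ ha)).1 h'
    exact hq.one_lt.ne' (Nat.dvd_one.1 (hgcd ▸ Nat.dvd_gcd hdvd hqN))
  have h0 : (a : ZMod q) ≠ 0 := by
    intro h
    rcases Nat.eq_zero_or_pos g with rfl | hg
    · exact h2 (pow_zero _)
    · rw [h, zero_pow (Nat.mul_pos hg hp.pos).ne'] at h1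
      exact zero_ne_one h1
  exact (hp.pow_dvd_of_dvd_mul_of_not_dvd (orderOf_dvd_of_pow_eq_one h1)
    (fun h => h2 (orderOf_dvd_iff_pow_eq_one.1 h)) he).trans
    (ZMod.orderOf_dvd_card_sub_one h0)

theorem pocklington_prime_power (p g B e a m N : ℕ) (hp : p.Prime)
    (hg : 1 ≤ g) (hB : 1 ≤ B) (he : 1 ≤ e) (ha : 1 ≤ a)
    (hm : m = g * p) (hN : N = m + 1) (hm' : m = B * p ^ e)
    (hBp : B < p ^ e) (hmod : a ^ m ≡ 1 [MOD N])
    (hgcd : Nat.gcd (a ^ g - 1) N = 1) : N.Prime := by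
  have hmpos : 0 < m := hm ▸ Nat.mul_pos hg hp.pos
  have hq : N.minFac.Prime := Nat.minFac_prime (by omega)
  have hdvd : p ^ e ∣ N.minFac - 1 :=
    hp.pow_dvd_sub_one_of_pocklington hq N.minFac_dvd ha
      (hm ▸ hm' ▸ Dvd.intro_left B rfl) (hm ▸ hmod) hgcd
  have hle : p ^ e ≤ N.minFac - 1 := Nat.le_of_dvd (Nat.sub_pos_of_lt hq.one_lt) hdvd
  by_contra hNp
  have hsq : N.minFac ^ 2 ≤ N := Nat.minFac_sq_le_self (by omega) hNp
  have hlt : p ^ e + 1 ≤ N.minFac := by have := hq.one_lt; omega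
  nlinarith [Nat.pow_le_pow_left hlt 2]
end
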